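/- Let d ≥ 2 and let P be the restriction to S^{d−1} of a polynomial on ℝ^d, with P ≥ 0 and P not identically zero, serving as the spectral spherical density of stable distributions (i.e., λ(dv) = P(v) ω(dv)). Set P_j = proj_j P and w_j(α) = π^{d/2} Γ(α+1) / (2^{α−1} Γ((j+α+d)/2) Γ((α−j)/2 + 1)). Then for every α ∈ (0,2) and every u ∈ S^{d−1}, the strict inequality Σ_{j even} w_j(α) P_j(u) > | Σ_{j odd} w_j(α) P_j(u) | holds. -/

import Mathlib

open MeasureTheory Real Filter Topology
open scoped RealInnerProductSpace ENNReal NNReal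

noncomputable section

namespace StablePaper

abbrev Ed (d : ℕ) : Type := EuclideanSpace ℝ (Fin d)

abbrev Sph (d : ℕ) := Metric.sphere (0 : Ed d) 1

/-- The surface measure `ω` on the unit sphere `S^{d-1}`. -/
def ωd (d : ℕ) : Measure (Sph d) := (volume : Measure (Ed d)).toSphere

/-- `u_z = z/|z|` for `z ≠ 0`, as a point of the unit sphere. -/
def unitize {d : ℕ} (z : Ed d) (hz : z ≠ 0) : Sph d :=
  ⟨‖z‖⁻¹ • z, by
    rw [mem_sphere_iff_norm, sub_zero, norm_smul, norm_inv, norm_norm,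
      inv_mul_cancel₀ (norm_ne_zero_iff.mpr hz)]⟩

/-- Negation on the unit sphere. -/
def negS {d : ℕ} (u : Sph d) : Sph d :=
  ⟨-(u : Ed d), by
    rw [mem_sphere_iff_norm, sub_zero, norm_neg]
    have := u.2
    rwa [mem_sphere_iff_norm, sub_zero] at this⟩

/-- Rising factorial (Pochhammer symbol) `(b)_n`. -/
def risingFactorial (b : ℝ) (n : ℕ) : ℝ := ∏ i ∈ Finset.range n, (b + i)

/-- The Gegenbauer polynomial `C_j^b(t)` (for `b > 0`), via its explicit sum formula. -/
def gegenbauer (b : ℝ) (j : ℕ) (t : ℝ) : ℝ :=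
  ∑ m ∈ Finset.range (j / 2 + 1),
    (-1 : ℝ) ^ m * 2 ^ (j - 2 * m) * risingFactorial b (j - m) /
      ((Nat.factorial m : ℝ) * (Nat.factorial (j - 2 * m) : ℝ)) * t ^ (j - 2 * m)

/-- The normalized (ultraspherical) polynomial `C̃_j^b(t) = C_j^b(t)/C_j^b(1)`;
for `b = 0` it is the Chebyshev polynomial `T_j`. -/
def gegenbauerN (b : ℝ) (j : ℕ) (t : ℝ) : ℝ :=
  if b = 0 then (Polynomial.Chebyshev.T ℝ (j : ℤ)).eval t
  else gegenbauer b j t / gegenbauer b j 1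

/-- `c_{j,d} = dim ℋ_{j,d}`. -/
def cdim (d j : ℕ) : ℕ :=
  if j = 0 then 1 else Nat.choose (j + d - 2) j + Nat.choose (j + d - 3) (j - 1)

/-- The surface area `A(S^{d-1}) = 2 π^{d/2} / Γ(d/2)`. -/
def sphereArea (d : ℕ) : ℝ := 2 * Real.pi ^ ((d : ℝ) / 2) / Real.Gamma ((d : ℝ) / 2)

/-- Projection onto spherical harmonics of degree `j` (real-valued version):
`(proj_j f)(u) = (c_{j,d}/A(S^{d-1})) ∫ C̃_j^{(d-2)/2}(⟨u,v⟩) f(v) ω(dv)`. -/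
def projR (d j : ℕ) (f : Sph d → ℝ) (u : Sph d) : ℝ :=
  (cdim d j : ℝ) / sphereArea d *
    ∫ v, gegenbauerN (((d : ℝ) - 2) / 2) j ⟪(u : Ed d), (v : Ed d)⟫ * f v ∂(ωd d)

/-- Projection onto spherical harmonics of degree `j` (complex-valued version). -/
def projC (d j : ℕ) (f : Sph d → ℂ) (u : Sph d) : ℂ :=
  ((cdim d j : ℂ) / (sphereArea d : ℂ)) *
    ∫ v, (gegenbauerN (((d : ℝ) - 2) / 2) j ⟪(u : Ed d), (v : Ed d)⟫ : ℂ) * f v ∂(ωd d)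

/-- The coefficients `w_j(α)`. -/
def w (d : ℕ) (α : ℝ) (j : ℕ) : ℝ :=
  Real.pi ^ ((d : ℝ) / 2) * Real.Gamma (α + 1) /
    (2 ^ (α - 1) * Real.Gamma (((j : ℝ) + α + d) / 2) * Real.Gamma ((α - j) / 2 + 1))

/-- The characteristic exponent of an `α`-stable distribution (`α ≠ 1`) with
spectral spherical measure `Λ`. -/
def charExp (d : ℕ) (α : ℝ) (Λ : Measure (Sph d)) (z : Ed d) : ℂ :=
  ∫ v, (|⟪z, (v : Ed d)⟫| ^ α : ℝ) *
      (1 - Complex.I * (Real.tan (Real.pi * α / 2) : ℂ) *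
        (Real.sign ⟪z, (v : Ed d)⟫ : ℂ)) ∂Λ

/-- `V(u)`, so that `Φ_μ(z) = |z|^α V(u_z)`. -/
def Vfun (d : ℕ) (α : ℝ) (Λ : Measure (Sph d)) (u : Sph d) : ℂ :=
  charExp d α Λ (u : Ed d)

/-- The characteristic exponent of a `1`-stable distribution with
spectral spherical measure `Λ`. -/
def charExp1 (d : ℕ) (Λ : Measure (Sph d)) (z : Ed d) : ℂ :=
  ∫ v, ((|⟪z, (v : Ed d)⟫| : ℝ) : ℂ) +
      Complex.I * ((2 / Real.pi * (⟪z, (v : Ed d)⟫ *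
        Real.log |⟪z, (v : Ed d)⟫|) : ℝ) : ℂ) ∂Λ

/-- The spectral spherical measure `λ(dv) = P(v) ω(dv)`. -/
def specMeasure (d : ℕ) (P : Sph d → ℝ) : Measure (Sph d) :=
  (ωd d).withDensity (fun v => ENNReal.ofReal (P v))

/-- `μ` has Fourier transform `exp (-Φ)` where `Φ` is the `α`-stable characteristic
exponent with spectral spherical measure `Λ` (case `α ≠ 1`). -/
def IsStableChar (d : ℕ) (α : ℝ) (Λ : Measure (Sph d)) (μ : Measure (Ed d)) : Prop :=
  ∀ z : Ed d, ∫ x, Complex.exp (Complex.I * (⟪z, x⟫ : ℂ)) ∂μ =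
    Complex.exp (- charExp d α Λ z)

/-- `μ` has Fourier transform `exp (-Φ)` where `Φ` is the `1`-stable characteristic
exponent with spectral spherical measure `Λ`. -/
def IsStableChar1 (d : ℕ) (Λ : Measure (Sph d)) (μ : Measure (Ed d)) : Prop :=
  ∀ z : Ed d, ∫ x, Complex.exp (Complex.I * (⟪z, x⟫ : ℂ)) ∂μ =
    Complex.exp (- charExp1 d Λ z)

/-- `μ` is nondegenerate: its support is not contained in any proper affine subspace. -/
def Nondegenerate (d : ℕ) (μ : Measure (Ed d)) : Prop :=
  ∀ (a : Ed d) (W : Submodule ℝ (Ed d)), W ≠ ⊤ →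
    μ ((fun x => a + x) '' (W : Set (Ed d))) < 1

/-- `P` is the restriction to the sphere of a polynomial on `ℝ^d`. -/
def IsPolyRestriction (d : ℕ) (P : Sph d → ℝ) : Prop :=
  ∃ p : MvPolynomial (Fin d) ℝ,
    ∀ u : Sph d, P u = MvPolynomial.eval (fun i => (u : Ed d) i) p

/-- `P` is the restriction to the sphere of a polynomial of degree at most `q`. -/
def IsPolyRestrictionDeg (d q : ℕ) (P : Sph d → ℝ) : Prop :=
  ∃ p : MvPolynomial (Fin d) ℝ, p.totalDegree ≤ q ∧
    ∀ u : Sph d, P u = MvPolynomial.eval (fun i => (u : Ed d) i) p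

/-- `f` is a spherical harmonic of degree `j`: the restriction to the sphere of a
homogeneous harmonic polynomial of degree `j`. -/
def IsSphericalHarmonicC (d j : ℕ) (f : Sph d → ℂ) : Prop :=
  ∃ p : MvPolynomial (Fin d) ℂ, p.IsHomogeneous j ∧
    (∑ i : Fin d, MvPolynomial.pderiv i (MvPolynomial.pderiv i p)) = 0 ∧
    ∀ u : Sph d, f u = MvPolynomial.eval (fun i => ((u : Ed d) i : ℂ)) p

/-- `S_{j,k} = (-i)^j proj_j (V^k)`. -/
def SHk (d : ℕ) (α : ℝ) (Λ : Measure (Sph d)) (j k : ℕ) (u : Sph d) : ℂ :=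
  (-Complex.I) ^ j * projC d j (fun v => (Vfun d α Λ v) ^ k) u

/-- `S_{j,p} = (-i)^j proj_j (V^p)` for real exponents `p` (principal branch). -/
def SHp (d : ℕ) (α : ℝ) (Λ : Measure (Sph d)) (j : ℕ) (p : ℝ) (u : Sph d) : ℂ :=
  (-Complex.I) ^ j * projC d j (fun v => (Vfun d α Λ v) ^ (p : ℂ)) u

/-- `g` is the density of the stable distribution with characteristic exponent
`charExp d α Λ`, given by the Fourier inversion formula. -/
def IsDensityOf (d : ℕ) (α : ℝ) (Λ : Measure (Sph d)) (g : Ed d → ℝ) : Prop :=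
  ∀ x : Ed d, (g x : ℂ) =
    (((2 * Real.pi) ^ d)⁻¹ : ℝ) *
      ∫ z : Ed d, Complex.exp (-(Complex.I * (⟪x, z⟫ : ℂ))) *
        Complex.exp (- charExp d α Λ z)

/-- Harmonic numbers `s_n`. -/
def harmonicNum (n : ℕ) : ℝ := ∑ i ∈ Finset.range n, (1 : ℝ) / (i + 1)

def betaD (d : ℕ) : ℝ :=
  if Even d then 1 - Real.log 2 - harmonicNum (d / 2) / 2
  else 1 - harmonicNum (d + 1) + harmonicNum ((d + 1) / 2) / 2

/-- The coefficients `w*_j` (for odd `j`). -/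
def wstar (d j : ℕ) : ℝ :=
  if j = 1 then Real.pi ^ ((d : ℝ) / 2) * betaD d / Real.Gamma ((d : ℝ) / 2 + 1)
  else (-1 : ℝ) ^ ((j - 3) / 2) * Real.pi ^ ((d : ℝ) / 2) *
      Real.Gamma (((j : ℝ) - 1) / 2) / (2 * Real.Gamma (((d : ℝ) + 1 + j) / 2))

/-- The Bessel function of the first kind `J_τ`. -/
def besselJ (τ : ℝ) (x : ℝ) : ℝ :=
  ∑' k : ℕ, (-1 : ℝ) ^ k * (x / 2) ^ (2 * (k : ℝ) + τ) /
    ((Nat.factorial k : ℝ) * Real.Gamma ((k : ℝ) + τ + 1))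

end StablePaper

namespace StablePaper

/-- `g` is positively homogeneous of degree `s`. -/
def PosHomogeneous (s : ℝ) (g : ℝ → ℝ) : Prop := ∀ r : ℝ, 0 < r → ∀ t, g (r * t) = r ^ s * g t

theorem PosHomogeneous.mul {s t : ℝ} {g h : ℝ → ℝ} (hg : PosHomogeneous s g)
    (hh : PosHomogeneous t h) : PosHomogeneous (s + t) (fun x => g x * h x) := by
  intro r hr x
  simp only [hg r hr, hh r hr, rpow_add hr]
  ring

theorem posHomogeneous_pow (n : ℕ) : PosHomogeneous n (fun x => x ^ n) := by
  intro r hr x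
  simp [mul_pow]

theorem PosHomogeneous.mul_self {s : ℝ} {g : ℝ → ℝ} (hg : PosHomogeneous s g) :
    PosHomogeneous (s + 1) (fun x => g x * x) := by
  simpa using hg.mul (posHomogeneous_pow 1)

theorem integral_rpow_mul_exp_neg_sq {s : ℝ} (hs : -1 < s) :
    ∫ x in Set.Ioi (0 : ℝ), x ^ s * exp (-x ^ 2) = Gamma ((s + 1) / 2) / 2 := by
  have := integral_rpow_mul_exp_neg_rpow (p := 2) two_pos hs
  simp only [rpow_two] at this
  rw [this]; ring

theorem integrableOn_rpow_mul_exp_neg_sq {s : ℝ} (hs : -1 < s) :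
    IntegrableOn (fun x : ℝ => x ^ s * exp (-x ^ 2)) (Set.Ioi (0 : ℝ)) := by
  simpa using integrableOn_rpow_mul_exp_neg_mul_sq (b := 1) one_pos hs

/-- Gaussian integral of a homogeneous function of one variable. -/
theorem PosHomogeneous.integral_mul_exp_neg_sq {s : ℝ} (hs : -1 < s) {g : ℝ → ℝ}
    (hg : PosHomogeneous s g) :
    ∫ x, g x * exp (-x ^ 2) = (g 1 + g (-1)) / 2 * Gamma ((s + 1) / 2) := by
  have h1 : ∀ x ∈ Set.Ioi (0 : ℝ), g x * exp (-x ^ 2) = g 1 * (x ^ s * exp (-x ^ 2)) := by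
    intro x hx
    have := hg x hx 1
    rw [mul_one] at this
    rw [this]; ring
  have h2 : ∀ x ∈ Set.Ioi (0 : ℝ), g (-x) * exp (-(-x) ^ 2) =
      g (-1) * (x ^ s * exp (-x ^ 2)) := by
    intro x hx
    have := hg x hx (-1)
    rw [mul_neg_one] at this
    rw [this, neg_sq]; ring
  have i1 : IntegrableOn (fun x => g x * exp (-x ^ 2)) (Set.Ioi (0 : ℝ)) :=
    IntegrableOn.congr_fun ((integrableOn_rpow_mul_exp_neg_sq hs).const_mul (g 1))
      (fun x hx => (h1 x hx).symm) measurableSet_Ioi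
  have i2 : IntegrableOn (fun x => g (-x) * exp (-(-x) ^ 2)) (Set.Ioi (0 : ℝ)) :=
    IntegrableOn.congr_fun ((integrableOn_rpow_mul_exp_neg_sq hs).const_mul (g (-1)))
      (fun x hx => (h2 x hx).symm) measurableSet_Ioi
  have i3 : IntegrableOn (fun x => g x * exp (-x ^ 2)) (Set.Iic (0 : ℝ)) := by
    have := (integrableOn_Ici_iff_integrableOn_Ioi (by finiteness)).2 i2
    have h := (Measure.measurePreserving_neg (volume : Measure ℝ)).integrableOn_comp_preimage
      (measurableEmbedding_neg) (f := fun x => g x * exp (-x ^ 2)) (s := Set.Iic (0 : ℝ))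
    rw [← h]
    simpa [Function.comp_def] using this
  rw [← intervalIntegral.integral_Iic_add_Ioi i3 i1]
  have h3 := integral_comp_neg_Ioi (0 : ℝ) (fun x => g x * exp (-x ^ 2))
  rw [neg_zero] at h3
  rw [← h3, setIntegral_congr_fun measurableSet_Ioi h1, setIntegral_congr_fun measurableSet_Ioi h2,
    integral_const_mul, integral_const_mul, integral_rpow_mul_exp_neg_sq hs]
  ring

/-- Gaussian integral of a homogeneous function in polar coordinates. -/
theorem integral_mul_exp_neg_norm_sq_eq_sphere {d : ℕ} (hd : 0 < d) {s : ℝ} (hs : 0 ≤ s)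
    {f : Ed d → ℝ} (hf : ∀ r : ℝ, 0 < r → ∀ x, f (r • x) = r ^ s * f x) :
    ∫ x, f x * exp (-‖x‖ ^ 2) = (∫ v : Sph d, f v ∂ωd d) * (Gamma ((s + d) / 2) / 2) := by
  have : NeZero d := ⟨hd.ne'⟩
  have : Nontrivial (Ed d) := by
    apply Module.nontrivial_of_finrank_pos (R := ℝ); simpa using hd
  set μ : Measure (Ed d) := volume
  calc
    ∫ x, f x * exp (-‖x‖ ^ 2) ∂μ
      = ∫ x : ({(0)}ᶜ : Set (Ed d)), f x * exp (-‖x.1‖ ^ 2) ∂(μ.comap (↑)) := by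
      rw [integral_subtype_comap (measurableSet_singleton _).compl
        fun x ↦ f x * exp (-‖x‖ ^ 2), restrict_compl_singleton]
    _ = ∫ x : Sph d × Set.Ioi (0 : ℝ), f x.1 * ((x.2 : ℝ) ^ s * exp (-(x.2 : ℝ) ^ 2))
          ∂μ.toSphere.prod (.volumeIoiPow (Module.finrank ℝ (Ed d) - 1)) := by
      rw [← μ.measurePreserving_homeomorphUnitSphereProd.integral_comp
        (Homeomorph.measurableEmbedding _)]
      refine integral_congr_ae (.of_forall fun x => ?_)
      have hx : (0 : ℝ) < ‖x.1‖ := norm_pos_iff.2 x.2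
      have h := hf ‖x.1‖ hx (‖x.1‖⁻¹ • x.1)
      rw [smul_inv_smul₀ hx.ne'] at h
      simp only [homeomorphUnitSphereProd_apply_snd_coe, homeomorphUnitSphereProd_apply_fst_coe]
      rw [h]; ring
    _ = (∫ v : Sph d, f v ∂ωd d) * ∫ x : Set.Ioi (0 : ℝ), (x : ℝ) ^ s * exp (-(x : ℝ) ^ 2)
          ∂(.volumeIoiPow (Module.finrank ℝ (Ed d) - 1)) :=
      integral_prod_mul (fun v : Sph d => f v)
        (fun x : Set.Ioi (0 : ℝ) => (x : ℝ) ^ s * exp (-(x : ℝ) ^ 2))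
    _ = _ := by
      congr 1
      simp only [Measure.volumeIoiPow, ENNReal.ofReal]
      rw [integral_withDensity_eq_integral_smul
        ((measurable_subtype_coe.pow_const _).real_toNNReal),
        integral_subtype_comap measurableSet_Ioi fun a : ℝ ↦
          Real.toNNReal (a ^ (Module.finrank ℝ (Ed d) - 1)) • (a ^ s * exp (-a ^ 2))]
      have hd1 : (1 : ℝ) ≤ d := by exact_mod_cast hd
      rw [show (s + d) / 2 = ((s + (d - 1)) + 1) / 2 by ring,
        ← integral_rpow_mul_exp_neg_sq (by linarith)]
      refine setIntegral_congr_fun measurableSet_Ioi fun x hx => ?_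
      have hx : 0 < x := hx
      simp only [NNReal.smul_def, Real.coe_toNNReal _ (pow_nonneg hx.le _), finrank_euclideanSpace,
        Fintype.card_fin, smul_eq_mul]
      rw [rpow_add hx, show (d : ℝ) - 1 = ((d - 1 : ℕ) : ℝ) by simp [Nat.cast_sub hd], rpow_natCast]
      ring

/-- Gaussian integral of a product of functions of the coordinates in an orthonormal basis. -/
theorem integral_prod_mul_exp_neg_norm_sq {d : ℕ} (b : OrthonormalBasis (Fin d) ℝ (Ed d))
    (f : Fin d → ℝ → ℝ) :
    ∫ x : Ed d, (∏ i, f i ⟪b i, x⟫) * exp (-‖x‖ ^ 2) = ∏ i, ∫ t, f i t * exp (-t ^ 2) := by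
  rw [← integral_fintype_prod_volume_eq_prod,
    ← b.measurePreserving_measurableEquiv.integral_comp'
      (g := fun y : Ed d => ∏ i, f i (y i) * exp (-(y i) ^ 2)) |>.trans
    ((EuclideanSpace.volume_preserving_symm_measurableEquiv_toLp (Fin d)).integral_comp'
      (g := fun y => ∏ i, f i (y i) * exp (-(y i) ^ 2)))]
  refine integral_congr_ae (.of_forall fun x => ?_)
  have hx : ‖x‖ ^ 2 = ∑ i, ⟪b i, x⟫ ^ 2 := by
    rw [← b.repr.norm_map, EuclideanSpace.norm_sq_eq]
    simp [b.repr_apply_apply]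
  simp only [Finset.prod_mul_distrib, ← Real.exp_sum, hx, Finset.sum_neg_distrib]
  congr 2 <;> simp [OrthonormalBasis.measurableEquiv, b.repr_apply_apply]

/-- Spherical integral of a product of homogeneous functions of the coordinates. -/
theorem integral_sphere_prod {d : ℕ} (hd : 0 < d) (b : OrthonormalBasis (Fin d) ℝ (Ed d))
    (s : Fin d → ℝ) (hs : ∀ i, 0 ≤ s i) (f : Fin d → ℝ → ℝ)
    (hf : ∀ i, PosHomogeneous (s i) (f i)) :
    (∫ v : Sph d, ∏ i, f i ⟪b i, (v : Ed d)⟫ ∂ωd d) * (Gamma ((∑ i, s i + d) / 2) / 2) =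
      ∏ i, ((f i 1 + f i (-1)) / 2 * Gamma ((s i + 1) / 2)) := by
  rw [← integral_mul_exp_neg_norm_sq_eq_sphere (f := fun x => ∏ i, f i ⟪b i, x⟫) hd
    (Finset.sum_nonneg fun i _ => hs i), integral_prod_mul_exp_neg_norm_sq b f]
  · exact Finset.prod_congr rfl fun i _ =>
      (hf i).integral_mul_exp_neg_sq (by linarith [hs i])
  · intro r hr x
    simp only [real_inner_smul_right, hf _ r hr, Finset.prod_mul_distrib]
    rw [Real.rpow_sum_of_pos hr]

theorem risingFactorial_succ (b : ℝ) (n : ℕ) :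
    risingFactorial b (n + 1) = risingFactorial b n * (b + n) :=
  Finset.prod_range_succ _ _

theorem risingFactorial_pos {b : ℝ} (hb : 0 < b) (n : ℕ) : 0 < risingFactorial b n :=
  Finset.prod_pos fun i _ => by positivity

/-- The `m`-th term of the explicit sum for `gegenbauer b n t`, extended by zero. -/
def gegenbauerTerm (b : ℝ) (n : ℕ) (t : ℝ) (m : ℕ) : ℝ :=
  if 2 * m ≤ n then
    (-1 : ℝ) ^ m * 2 ^ (n - 2 * m) * risingFactorial b (n - m) /
      ((Nat.factorial m : ℝ) * (Nat.factorial (n - 2 * m) : ℝ)) * t ^ (n - 2 * m)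
  else 0

theorem gegenbauer_eq_sum (b : ℝ) (n N : ℕ) (hN : n / 2 + 1 ≤ N) (t : ℝ) :
    gegenbauer b n t = ∑ m ∈ Finset.range N, gegenbauerTerm b n t m := by
  rw [gegenbauer, ← Finset.sum_subset (Finset.range_subset_range.2 hN)]
  · refine Finset.sum_congr rfl fun m hm => ?_
    rw [gegenbauerTerm, if_pos]
    have := Finset.mem_range.1 hm
    omega
  · intro m _ hm
    rw [gegenbauerTerm, if_neg]
    rw [Finset.mem_range] at hm
    omega

theorem gegenbauerTerm_zero_rec (b : ℝ) (n : ℕ) (t : ℝ) :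
    ((n : ℝ) + 2) * gegenbauerTerm b (n + 2) t 0 =
      2 * (n + 1 + b) * t * gegenbauerTerm b (n + 1) t 0 := by
  simp only [gegenbauerTerm, mul_zero, Nat.zero_le, if_true, Nat.sub_zero,
    risingFactorial_succ b (n + 1), Nat.factorial_succ (n + 1)]
  have := Nat.factorial_ne_zero (n + 1)
  push_cast
  field_simp
  ring

theorem gegenbauerTerm_succ_rec (b : ℝ) (n m : ℕ) (hm : 2 * m ≤ n) (t : ℝ) :
    ((n : ℝ) + 2) * gegenbauerTerm b (n + 2) t (m + 1) =
      2 * (n + 1 + b) * t * gegenbauerTerm b (n + 1) t (m + 1) -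
        (n + 2 * b) * gegenbauerTerm b n t m := by
  obtain ⟨i, rfl⟩ := Nat.exists_eq_add_of_le hm
  have e1 : 2 * m + i + 2 - 2 * (m + 1) = i := by omega
  have e2 : 2 * m + i + 2 - (m + 1) = (m + i) + 1 := by omega
  have e3 : 2 * m + i - 2 * m = i := by omega
  have e4 : 2 * m + i - m = m + i := by omega
  have e5 : 2 * m + i + 1 - (m + 1) = m + i := by omega
  have f1 := Nat.factorial_ne_zero m
  simp only [gegenbauerTerm, e1, e2, e3, e4, e5, if_pos hm,
    if_pos (show 2 * (m + 1) ≤ 2 * m + i + 2 by omega), risingFactorial_succ,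
    Nat.factorial_succ m]
  rcases i with _ | i
  · rw [if_neg (by omega)]
    simp only [add_zero, Nat.factorial_zero]
    push_cast
    field_simp
    ring
  · rw [if_pos (by omega), show 2 * m + (i + 1) + 1 - 2 * (m + 1) = i by omega]
    have f2 := Nat.factorial_ne_zero i
    simp only [Nat.factorial_succ i]
    push_cast
    field_simp
    ring

theorem gegenbauer_rec (b : ℝ) (n : ℕ) (t : ℝ) :
    ((n : ℝ) + 2) * gegenbauer b (n + 2) t =
      2 * (n + 1 + b) * t * gegenbauer b (n + 1) t - (n + 2 * b) * gegenbauer b n t := by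
  rw [gegenbauer_eq_sum b (n + 2) (n / 2 + 1 + 1) (by omega),
    gegenbauer_eq_sum b (n + 1) (n / 2 + 1 + 1) (by omega),
    gegenbauer_eq_sum b n (n / 2 + 1) le_rfl, Finset.sum_range_succ' _ (n / 2 + 1),
    Finset.sum_range_succ' _ (n / 2 + 1),
    mul_add, mul_add, gegenbauerTerm_zero_rec, Finset.mul_sum, Finset.mul_sum, Finset.mul_sum,
    add_sub_right_comm, ← Finset.sum_sub_distrib]
  congr 1
  refine Finset.sum_congr rfl fun m hm => gegenbauerTerm_succ_rec b n m ?_ t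
  have := Finset.mem_range.1 hm
  omega

theorem gegenbauer_zero_right (b t : ℝ) : gegenbauer b 0 t = 1 := by
  simp [gegenbauer, risingFactorial]

theorem gegenbauer_one_right (b t : ℝ) : gegenbauer b 1 t = 2 * b * t := by
  simp [gegenbauer, risingFactorial]

theorem gegenbauer_eval_one (b : ℝ) (n : ℕ) :
    gegenbauer b n 1 = risingFactorial (2 * b) n / (Nat.factorial n : ℝ) := by
  induction n using Nat.twoStepInduction with
  | zero => simp [gegenbauer_zero_right, risingFactorial]
  | one => simp [gegenbauer_one_right, risingFactorial]
  | more n h0 h1 =>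
    have h := gegenbauer_rec b n 1
    rw [h0, h1] at h
    have hn : (n : ℝ) + 2 ≠ 0 := by positivity
    rw [← mul_right_inj' hn, h]
    have := Nat.factorial_ne_zero n
    simp only [risingFactorial_succ, Nat.factorial_succ]
    push_cast
    field_simp
    ring

open Polynomial in
/-- The ultraspherical polynomials normalized to take the value `1` at `1`,
defined by their three-term recurrence. -/
def ultraspherical (b : ℝ) : ℕ → ℝ[X]
  | 0 => 1
  | 1 => X
  | n + 2 => C (2 * (n + 1 + b) / (n + 1 + 2 * b)) * (ultraspherical b (n + 1) * X) -
      C ((n + 1) / (n + 1 + 2 * b)) * ultraspherical b n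

theorem gegenbauerN_eq_eval {b : ℝ} (hb : 0 ≤ b) (n : ℕ) (t : ℝ) :
    gegenbauerN b n t = (ultraspherical b n).eval t := by
  rcases hb.eq_or_lt with rfl | hb
  · rw [gegenbauerN, if_pos rfl]
    congr 1
    induction n using Nat.twoStepInduction with
    | zero => simp [ultraspherical]
    | one => simp [ultraspherical]
    | more n h0 h1 =>
      have hn : (n : ℝ) + 1 ≠ 0 := by positivity
      push_cast at h1 ⊢
      rw [Polynomial.Chebyshev.T_add_two, h0, h1, ultraspherical]
      simp only [mul_zero, add_zero, mul_div_assoc, div_self hn, mul_one, map_one, one_mul,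
        map_ofNat]
      ring
  · rw [gegenbauerN, if_neg hb.ne']
    induction n using Nat.twoStepInduction with
    | zero => simp [ultraspherical, gegenbauer_zero_right]
    | one => simp [ultraspherical, gegenbauer_one_right]; field_simp
    | more n h0 h1 =>
      simp only [ultraspherical, Polynomial.eval_sub, Polynomial.eval_mul, Polynomial.eval_C,
        Polynomial.eval_X, ← h0, ← h1]
      have h := gegenbauer_rec b n t
      have hn : (n : ℝ) + 2 ≠ 0 := by positivity
      have h2 : gegenbauer b (n + 2) t = (2 * (n + 1 + b) * t * gegenbauer b (n + 1) t -
        (n + 2 * b) * gegenbauer b n t) / (n + 2) := by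
        rw [← h]; field_simp
      have := Nat.factorial_ne_zero n
      have hr := (risingFactorial_pos (mul_pos two_pos hb) n).ne'
      have h3 : 2 * b + n ≠ 0 := by positivity
      have h4 : (n : ℝ) + 1 + 2 * b ≠ 0 := by positivity
      have h5 : 2 * b + (n + 1) ≠ 0 := by positivity
      rw [h2]
      simp only [gegenbauer_eval_one, risingFactorial_succ, Nat.factorial_succ]
      push_cast
      field_simp
      ring

/-- The leading coefficient of `ultraspherical b n`. -/
def ultrasphericalLead (b : ℝ) : ℕ → ℝ
  | 0 => 1
  | 1 => 1
  | n + 2 => 2 * (n + 1 + b) / (n + 1 + 2 * b) * ultrasphericalLead b (n + 1)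

theorem ultrasphericalLead_pos {b : ℝ} (hb : 0 ≤ b) (n : ℕ) : 0 < ultrasphericalLead b n := by
  induction n using Nat.twoStepInduction with
  | zero => exact one_pos
  | one => exact one_pos
  | more n _ h => rw [ultrasphericalLead]; positivity

theorem ultraspherical_natDegree_le_and_coeff (b : ℝ) (n : ℕ) :
    (ultraspherical b n).natDegree ≤ n ∧
      (ultraspherical b n).coeff n = ultrasphericalLead b n := by
  induction n using Nat.twoStepInduction with
  | zero => simp [ultraspherical, ultrasphericalLead]
  | one => simp [ultraspherical, ultrasphericalLead]
  | more n h0 h1 =>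
    have h2 : (ultraspherical b n).coeff (n + 2) = 0 :=
      Polynomial.coeff_eq_zero_of_natDegree_lt (by omega)
    constructor
    · rw [ultraspherical]
      refine (Polynomial.natDegree_sub_le _ _).trans (max_le ?_ ?_)
      · refine (Polynomial.natDegree_C_mul_le _ _).trans ?_
        refine Polynomial.natDegree_mul_le.trans ?_
        have := h1.1
        simp only [Polynomial.natDegree_X]
        omega
      · exact (Polynomial.natDegree_C_mul_le _ _).trans (by omega)
    · rw [ultraspherical, Polynomial.coeff_sub, Polynomial.coeff_C_mul, Polynomial.coeff_C_mul,
        Polynomial.coeff_mul_X, h1.2, h2, mul_zero, sub_zero, ultrasphericalLead]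

/-- The polynomials `ultraspherical b n` as a polynomial sequence. -/
def ultrasphericalSequence (b : ℝ) (hb : 0 ≤ b) : Polynomial.Sequence ℝ where
  elems' := ultraspherical b
  degree_eq' n := by
    obtain ⟨h1, h2⟩ := ultraspherical_natDegree_le_and_coeff b n
    exact Polynomial.degree_eq_of_le_of_coeff_ne_zero
      (Polynomial.degree_le_of_natDegree_le h1) (h2 ▸ (ultrasphericalLead_pos hb n).ne')

theorem span_range_ultraspherical {b : ℝ} (hb : 0 ≤ b) :
    Submodule.span ℝ (Set.range (ultraspherical b)) = ⊤ :=
  (ultrasphericalSequence b hb).span fun i =>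
    (Polynomial.leadingCoeff_ne_zero.2 ((ultrasphericalSequence b hb).ne_zero i)).isUnit

theorem factorial_mul_cdim (e k : ℕ) :
    Nat.factorial (k + 1) * Nat.factorial e * cdim (e + 2) (k + 1) =
      (2 * k + 2 + e) * Nat.factorial (k + e) := by
  have h1 := Nat.add_choose_mul_factorial_mul_factorial (k + 1) e
  have h2 := Nat.add_choose_mul_factorial_mul_factorial k e
  rw [cdim, if_neg (by omega), show k + 1 + (e + 2) - 2 = k + 1 + e by omega,
    show k + 1 + (e + 2) - 3 = k + e by omega, Nat.add_sub_cancel]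
  rw [← Nat.choose_symm_add] at h1 h2
  rw [show k + 1 + e = (k + e) + 1 by omega, Nat.factorial_succ (k + e)] at h1
  rw [Nat.factorial_succ] at h1 ⊢
  rw [show k + 1 + e = (k + e) + 1 by omega]
  linear_combination h1 + (k + 1) * h2

instance (d : ℕ) : IsFiniteMeasure (ωd d) := by unfold ωd; infer_instance

instance (d : ℕ) : (ωd d).IsOpenPosMeasure := by unfold ωd; infer_instance

theorem integrable_of_continuous_sphere {d : ℕ} {f : Sph d → ℝ} (hf : Continuous f) :
    Integrable f (ωd d) :=
  hf.integrable_of_hasCompactSupport (HasCompactSupport.of_compactSpace f)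

theorem exists_orthonormalBasis_apply_eq {d : ℕ} (i₀ : Fin d) (u : Sph d) :
    ∃ b : OrthonormalBasis (Fin d) ℝ (Ed d), b i₀ = (u : Ed d) := by
  have hv : Orthonormal ℝ (({i₀} : Set (Fin d)).domRestrict fun _ => (u : Ed d)) := by
    refine ⟨fun i => by simp, fun i j hij => absurd (Subsingleton.elim i j) hij⟩
  obtain ⟨b, hb⟩ := hv.exists_orthonormalBasis_extension_of_card_eq (by simp)
  exact ⟨b, hb i₀ rfl⟩

theorem integral_sphere_mul_monomial {d : ℕ} (b : OrthonormalBasis (Fin d) ℝ (Ed d)) (i₀ : Fin d)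
    {s : ℝ} (hs : 0 ≤ s) {g : ℝ → ℝ} (hg : PosHomogeneous s g) (β : Fin d → ℕ) :
    (∫ v : Sph d, g ⟪b i₀, (v : Ed d)⟫ * ∏ i, ⟪b i, (v : Ed d)⟫ ^ β i ∂ωd d) *
        (Gamma ((s + ∑ i, (β i : ℝ) + d) / 2) / 2) =
      (g 1 + (-1) ^ β i₀ * g (-1)) / 2 * Gamma ((s + β i₀ + 1) / 2) *
        ∏ i ∈ Finset.univ.erase i₀, ((1 + (-1) ^ β i) / 2 * Gamma ((β i + 1) / 2)) := by
  have hmem : i₀ ∈ Finset.univ := Finset.mem_univ i₀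
  have h := integral_sphere_prod i₀.pos b (fun i => if i = i₀ then s + β i else β i)
    (fun i => by split_ifs <;> positivity)
    (fun i x => if i = i₀ then g x * x ^ β i else x ^ β i) (fun i => by
      split_ifs
      exacts [hg.mul (posHomogeneous_pow _), posHomogeneous_pow _])
  have e1 : ∀ v : Sph d, ∏ i, (if i = i₀ then g ⟪b i, (v : Ed d)⟫ * ⟪b i, (v : Ed d)⟫ ^ β i
      else ⟪b i, (v : Ed d)⟫ ^ β i) =
      g ⟪b i₀, (v : Ed d)⟫ * ∏ i, ⟪b i, (v : Ed d)⟫ ^ β i := by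
    intro v
    rw [← Finset.mul_prod_erase _ _ hmem, ← Finset.mul_prod_erase _ (fun i => _ ^ β i) hmem,
      if_pos rfl, mul_assoc]
    congr 2
    exact Finset.prod_congr rfl fun i hi => if_neg (Finset.ne_of_mem_erase hi)
  have e2 : ∑ i, (if i = i₀ then s + (β i : ℝ) else β i) = s + ∑ i, (β i : ℝ) := by
    rw [← Finset.add_sum_erase _ _ hmem, ← Finset.add_sum_erase _ (fun i => (β i : ℝ)) hmem,
      if_pos rfl, add_assoc]
    congr 2
    exact Finset.sum_congr rfl fun i hi => if_neg (Finset.ne_of_mem_erase hi)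
  simp only [e1, e2] at h
  rw [h, ← Finset.mul_prod_erase _ _ hmem]
  simp only [if_true, one_pow, mul_one]
  congr 1
  · ring
  · refine Finset.prod_congr rfl fun i hi => ?_
    simp only [if_neg (Finset.ne_of_mem_erase hi)]

theorem w_zero_right {d : ℕ} (hd : 0 < d) {s : ℝ} (hs : 0 ≤ s) :
    w d s 0 * (Gamma ((s + d) / 2) / 2) = Gamma ((s + 1) / 2) * √π ^ (d - 1) := by
  have hdup := Real.Gamma_mul_Gamma_add_half ((s + 1) / 2)
  rw [show (s + 1) / 2 + 1 / 2 = s / 2 + 1 by ring, show 2 * ((s + 1) / 2) = s + 1 by ring,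
    show 1 - (s + 1) = -s by ring] at hdup
  have h1 : Gamma ((s + d) / 2) ≠ 0 := (Gamma_pos_of_pos (by positivity)).ne'
  have h2 : Gamma (s / 2 + 1) ≠ 0 := (Gamma_pos_of_pos (by positivity)).ne'
  have h3 : (2 : ℝ) ^ s ≠ 0 := by positivity
  have h4 : π ^ ((d : ℝ) / 2) = √π ^ (d - 1) * √π := by
    rw [← pow_succ, Nat.sub_add_cancel hd, Real.sqrt_eq_rpow, ← rpow_natCast, ← rpow_mul pi_nonneg]
    congr 1; ring
  have h5 : Gamma ((s + 1) / 2) = Gamma (s + 1) * 2 ^ (-s) * √π / Gamma (s / 2 + 1) := by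
    rw [← hdup]; field_simp
  rw [w, h5, h4, rpow_sub_one two_ne_zero, rpow_neg two_pos.le]
  simp only [Nat.cast_zero, zero_add, sub_zero]
  field_simp

theorem integral_sphere_posHomogeneous {d : ℕ} (hd : 0 < d) {s : ℝ} (hs : 0 ≤ s) {g : ℝ → ℝ}
    (hg : PosHomogeneous s g) (u : Sph d) :
    ∫ v : Sph d, g ⟪(u : Ed d), (v : Ed d)⟫ ∂ωd d = (g 1 + g (-1)) / 2 * w d s 0 := by
  obtain ⟨b, hb⟩ := exists_orthonormalBasis_apply_eq ⟨0, hd⟩ u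
  have h := integral_sphere_mul_monomial b ⟨0, hd⟩ hs hg 0
  have hΓ : Gamma ((s + d) / 2) / 2 ≠ 0 :=
    div_ne_zero (Gamma_pos_of_pos (by positivity)).ne' two_ne_zero
  rw [← mul_left_inj' hΓ, mul_assoc, w_zero_right hd hs]
  simp only [Pi.zero_apply, pow_zero, Finset.prod_const_one, mul_one, Nat.cast_zero,
    Finset.sum_const_zero, add_zero, one_mul, zero_add, Finset.prod_const, hb,
    Finset.card_erase_of_mem (Finset.mem_univ _), Finset.card_univ, Fintype.card_fin] at h
  rw [h, Real.Gamma_one_half_eq]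
  ring

theorem one_div_Gamma_eq (y : ℝ) : 1 / Gamma y = y * (1 / Gamma (y + 1)) := by
  by_cases hy : y = 0
  · simp [hy, Gamma_zero]
  · rw [Gamma_add_one hy]
    by_cases h : Gamma y = 0
    · simp [h]
    · field_simp

theorem w_one_right (d : ℕ) (s : ℝ) (hs : 0 ≤ s) : w d s 1 = w d (s + 1) 0 := by
  have h : Gamma ((s + 1) / 2 + 1) = (s + 1) / 2 * Gamma ((s + 1) / 2) :=
    Gamma_add_one (by positivity)
  have h' : Gamma (s + 1 + 1) = (s + 1) * Gamma (s + 1) := Gamma_add_one (by positivity)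
  have hΓ : Gamma ((s + 1) / 2) ≠ 0 := (Gamma_pos_of_pos (by positivity)).ne'
  have h2 : (2 : ℝ) ^ s ≠ 0 := by positivity
  have hs1 : s + 1 ≠ 0 := by positivity
  simp only [w, Nat.cast_zero, Nat.cast_one, zero_add, sub_zero, h, h',
    show (s - 1) / 2 + 1 = (s + 1) / 2 by ring, add_comm (1 : ℝ) s, rpow_sub_one two_ne_zero,
    rpow_add_one two_ne_zero]
  by_cases hd : Gamma ((s + 1 + d) / 2) = 0
  · simp [hd]
  · field_simp

theorem w_rec {d : ℕ} (hd : 0 < d) (n : ℕ) {s : ℝ} (hs : 0 ≤ s) :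
    ((n : ℝ) + 1 + 2 * (((d : ℝ) - 2) / 2)) * w d s (n + 2) =
      2 * (n + 1 + ((d : ℝ) - 2) / 2) * w d (s + 1) (n + 1) - (n + 1) * w d s n := by
  set X : ℝ := (n + s + d) / 2 with hX
  set Y : ℝ := (s - n) / 2 with hY
  have hXpos : 0 < X := by positivity
  have e1 : Gamma (X + 1) = X * Gamma X := Gamma_add_one hXpos.ne'
  have e3 : Gamma (s + 1 + 1) = (s + 1) * Gamma (s + 1) := Gamma_add_one (by positivity)
  have hΓ : Gamma X ≠ 0 := (Gamma_pos_of_pos hXpos).ne'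
  have h2 : (2 : ℝ) ^ s ≠ 0 := by positivity
  have key : ∀ (a c p q : ℝ), a / (c * p * q) = a / (c * p) * (1 / q) := by
    intro a c p q; rw [mul_one_div, div_div]
  simp only [w, key]
  push_cast
  rw [show ((n : ℝ) + 2 + s + d) / 2 = X + 1 by rw [hX]; ring,
    show ((n : ℝ) + 1 + (s + 1) + d) / 2 = X + 1 by rw [hX]; ring,
    show (s - (n + 2)) / 2 + 1 = Y by rw [hY]; ring,
    show (s + 1 - (n + 1)) / 2 + 1 = Y + 1 by rw [hY]; ring, one_div_Gamma_eq Y,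
    e1, e3, rpow_sub_one two_ne_zero, rpow_sub_one two_ne_zero, rpow_add_one two_ne_zero]
  generalize 1 / Gamma (Y + 1) = c
  have hX0 := hXpos.ne'
  field_simp
  rw [hX, hY]
  ring

/-- **Funk–Hecke formula** for homogeneous zonal functions. -/
theorem integral_sphere_mul_ultraspherical {d : ℕ} (hd : 2 ≤ d) (u : Sph d) (k : ℕ) {s : ℝ}
    (hs : 0 ≤ s) {g : ℝ → ℝ} (hgc : Continuous g) (hg : PosHomogeneous s g) :
    ∫ v : Sph d, g ⟪(u : Ed d), (v : Ed d)⟫ *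
        (ultraspherical (((d : ℝ) - 2) / 2) k).eval ⟪(u : Ed d), (v : Ed d)⟫ ∂ωd d =
      (g 1 + (-1) ^ k * g (-1)) / 2 * w d s k := by
  have hd0 : 0 < d := by omega
  have hd2 : (2 : ℝ) ≤ d := by exact_mod_cast hd
  induction k using Nat.twoStepInduction generalizing s g with
  | zero => simp [ultraspherical, integral_sphere_posHomogeneous hd0 hs hg]
  | one =>
    simp [ultraspherical, integral_sphere_posHomogeneous hd0 (by positivity) hg.mul_self,
      w_one_right d s hs]
  | more n h0 h1 =>
    set b : ℝ := ((d : ℝ) - 2) / 2 with hb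
    have hb0 : 0 ≤ b := by rw [hb]; linarith
    have hn : (n : ℝ) + 1 + 2 * b ≠ 0 := by positivity
    have e1 := h1 (s := s + 1) (g := fun x => g x * x) (by positivity)
      (hgc.mul continuous_id) hg.mul_self
    have e0 := h0 hs hgc hg
    have hw : w d s (n + 2) = (2 * (n + 1 + b) * w d (s + 1) (n + 1) - (n + 1) * w d s n) /
        (n + 1 + 2 * b) := by
      rw [eq_div_iff hn, mul_comm]; exact w_rec hd0 n hs
    have hsplit : ∀ t : ℝ, g t * (ultraspherical b (n + 2)).eval t =
        2 * (n + 1 + b) / (n + 1 + 2 * b) * (g t * t * (ultraspherical b (n + 1)).eval t) -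
          (n + 1) / (n + 1 + 2 * b) * (g t * (ultraspherical b n).eval t) := by
      intro t
      simp only [ultraspherical, Polynomial.eval_sub, Polynomial.eval_mul, Polynomial.eval_C,
        Polynomial.eval_X]
      ring
    simp only [hsplit]
    rw [integral_sub, integral_const_mul, integral_const_mul, e0, e1, hw]
    · field_simp
      ring
    · exact integrable_of_continuous_sphere (by fun_prop)
    · exact integrable_of_continuous_sphere (by fun_prop)

theorem w_natCast_eq_zero (d : ℕ) {n k : ℕ} (hnk : n < k) (h : Even (k + n)) : w d n k = 0 := by
  obtain ⟨m, rfl⟩ : ∃ m, k = n + 2 * m + 2 := by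
    obtain ⟨r, hr⟩ := h
    exact ⟨r - n - 1, by omega⟩
  rw [w, show ((n : ℝ) - ((n + 2 * m + 2 : ℕ) : ℝ)) / 2 + 1 = -(m : ℝ) by push_cast; ring,
    Gamma_neg_nat_eq_zero, mul_zero, div_zero]

theorem integral_pow_mul_ultraspherical {d : ℕ} (hd : 2 ≤ d) (u : Sph d) {n k : ℕ} (hn : n ≤ k) :
    ∫ v : Sph d, ⟪(u : Ed d), (v : Ed d)⟫ ^ n *
        (ultraspherical (((d : ℝ) - 2) / 2) k).eval ⟪(u : Ed d), (v : Ed d)⟫ ∂ωd d =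
      if n = k then w d k k else 0 := by
  rw [integral_sphere_mul_ultraspherical hd u k (Nat.cast_nonneg n)
    (continuous_pow n) (posHomogeneous_pow n), one_pow, ← pow_add]
  rcases hn.eq_or_lt with rfl | hlt
  · rw [if_pos rfl, Even.neg_one_pow ⟨n, rfl⟩]
    ring
  · rw [if_neg hlt.ne]
    rcases Nat.even_or_odd (k + n) with h | h
    · rw [w_natCast_eq_zero d hlt h, mul_zero]
    · rw [h.neg_one_pow]; norm_num

theorem integral_polynomial_mul_ultraspherical {d : ℕ} (hd : 2 ≤ d) (u : Sph d) {k : ℕ}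
    {q : Polynomial ℝ} (hq : q.natDegree ≤ k) :
    ∫ v : Sph d, q.eval ⟪(u : Ed d), (v : Ed d)⟫ *
        (ultraspherical (((d : ℝ) - 2) / 2) k).eval ⟪(u : Ed d), (v : Ed d)⟫ ∂ωd d =
      q.coeff k * w d k k := by
  simp only [Polynomial.eval_eq_sum_range' (p := q) (n := k + 1) (by omega), Finset.sum_mul,
    mul_assoc]
  rw [integral_finsetSum _ fun n _ => integrable_of_continuous_sphere (by fun_prop)]
  simp only [integral_const_mul]
  rw [Finset.sum_congr rfl fun n hn => by
    rw [integral_pow_mul_ultraspherical hd u (Nat.lt_succ_iff.1 (Finset.mem_range.1 hn))]]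
  simp

theorem cdim_mul_lead_mul_w {d : ℕ} (hd : 2 ≤ d) (k : ℕ) :
    (cdim d k : ℝ) / sphereArea d * (ultrasphericalLead (((d : ℝ) - 2) / 2) k * w d k k) = 1 := by
  obtain ⟨e, rfl⟩ := Nat.exists_eq_add_of_le' hd
  have hΓ : Gamma (((e + 2 : ℕ) : ℝ) / 2) ≠ 0 := (Gamma_pos_of_pos (by positivity)).ne'
  have hπ : π ^ (((e + 2 : ℕ) : ℝ) / 2) ≠ 0 := by positivity
  have hA : sphereArea (e + 2) ≠ 0 := by rw [sphereArea]; positivity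
  rw [div_mul_eq_mul_div, div_eq_one_iff_eq hA]
  rcases k with _ | k
  · rw [cdim, if_pos rfl, sphereArea, ultrasphericalLead, w]
    norm_num [rpow_neg]
    field_simp
  have hc : ∀ k : ℕ, (cdim (e + 2) (k + 1) : ℝ) =
      (2 * k + 2 + e) * Nat.factorial (k + e) / (Nat.factorial (k + 1) * Nat.factorial e) := by
    intro k
    have h1 := Nat.factorial_ne_zero (k + 1)
    have h2 := Nat.factorial_ne_zero e
    rw [eq_div_iff (by positivity)]
    have := factorial_mul_cdim e k
    rw [mul_comm]
    exact_mod_cast this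
  have hw : ∀ k : ℕ, w (e + 2) k k = π ^ (((e + 2 : ℕ) : ℝ) / 2) * Nat.factorial k * 2 /
      (2 ^ k * Gamma (k + ((e + 2 : ℕ) : ℝ) / 2)) := by
    intro k
    rw [w, Gamma_nat_eq_factorial, sub_self, zero_div, zero_add, Gamma_one, mul_one,
      rpow_sub_one two_ne_zero, rpow_natCast, show ((k : ℝ) + k + ((e + 2 : ℕ) : ℝ)) / 2 =
        k + ((e + 2 : ℕ) : ℝ) / 2 by ring]
    field_simp
  have hG : ∀ k : ℕ, Gamma (((k + 1 : ℕ) : ℝ) + ((e + 2 : ℕ) : ℝ) / 2) =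
      (k + ((e + 2 : ℕ) : ℝ) / 2) * Gamma (k + ((e + 2 : ℕ) : ℝ) / 2) := by
    intro k
    rw [← Gamma_add_one (by positivity)]
    congr 1; push_cast; ring
  induction k with
  | zero =>
    have h2 := Nat.factorial_ne_zero e
    rw [hc, hw, hG, ultrasphericalLead, sphereArea]
    norm_num
    field_simp
    ring
  | succ k ih =>
    rw [← ih, hc, hc, hw, hw, hG (k + 1), ultrasphericalLead]
    have h1 := Nat.factorial_ne_zero (k + 1)
    have h2 := Nat.factorial_ne_zero e
    have h3 : Gamma (((k + 1 : ℕ) : ℝ) + ((e + 2 : ℕ) : ℝ) / 2) ≠ 0 :=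
      (Gamma_pos_of_pos (by positivity)).ne'
    generalize Gamma (((k + 1 : ℕ) : ℝ) + ((e + 2 : ℕ) : ℝ) / 2) = y at *
    generalize π ^ (((e + 2 : ℕ) : ℝ) / 2) = x at *
    generalize ultrasphericalLead _ _ = l
    rw [show k + 1 + e = k + e + 1 by omega, Nat.factorial_succ (k + 1),
      Nat.factorial_succ (k + e)]
    push_cast
    rw [show (e : ℝ) + 2 - 2 = e by ring]
    field_simp
    ring

theorem integral_ultraspherical_mul_ultraspherical {d : ℕ} (hd : 2 ≤ d) (u : Sph d) (j k : ℕ) :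
    ∫ v : Sph d, (ultraspherical (((d : ℝ) - 2) / 2) j).eval ⟪(u : Ed d), (v : Ed d)⟫ *
        (ultraspherical (((d : ℝ) - 2) / 2) k).eval ⟪(u : Ed d), (v : Ed d)⟫ ∂ωd d =
      if j = k then ultrasphericalLead (((d : ℝ) - 2) / 2) k * w d k k else 0 := by
  have hdeg := ultraspherical_natDegree_le_and_coeff (((d : ℝ) - 2) / 2)
  rcases lt_trichotomy j k with h | rfl | h
  · rw [integral_polynomial_mul_ultraspherical hd u ((hdeg j).1.trans h.le), if_neg h.ne,
      Polynomial.coeff_eq_zero_of_natDegree_lt ((hdeg j).1.trans_lt h), zero_mul]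
  · rw [integral_polynomial_mul_ultraspherical hd u (hdeg j).1, if_pos rfl, (hdeg j).2]
  · simp only [mul_comm (Polynomial.eval _ (ultraspherical _ j))]
    rw [integral_polynomial_mul_ultraspherical hd u ((hdeg k).1.trans h.le), if_neg h.ne',
      Polynomial.coeff_eq_zero_of_natDegree_lt ((hdeg k).1.trans_lt h), zero_mul]

/-- Funk-Hecke expansion of a zonal polynomial. -/
theorem hasSum_integral_sphere_mul_polynomial {d : ℕ} (hd : 2 ≤ d) (u : Sph d) {s : ℝ}
    (hs : 0 ≤ s) {g : ℝ → ℝ} (hgc : Continuous g) (hg : PosHomogeneous s g) (q : Polynomial ℝ) :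
    HasSum (fun j : ℕ => (cdim d j : ℝ) / sphereArea d *
        (∫ v : Sph d, (ultraspherical (((d : ℝ) - 2) / 2) j).eval ⟪(u : Ed d), (v : Ed d)⟫ *
          q.eval ⟪(u : Ed d), (v : Ed d)⟫ ∂ωd d) *
        ((g 1 + (-1) ^ j * g (-1)) / 2 * w d s j))
      (∫ v : Sph d, g ⟪(u : Ed d), (v : Ed d)⟫ * q.eval ⟪(u : Ed d), (v : Ed d)⟫ ∂ωd d) := by
  have hb : 0 ≤ ((d : ℝ) - 2) / 2 := by
    have : (2 : ℝ) ≤ d := by exact_mod_cast hd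
    linarith
  have hq : q ∈ Submodule.span ℝ (Set.range (ultraspherical (((d : ℝ) - 2) / 2))) := by
    rw [span_range_ultraspherical hb]; trivial
  induction hq using Submodule.span_induction with
  | mem x hx =>
    obtain ⟨k, rfl⟩ := hx
    rw [integral_sphere_mul_ultraspherical hd u k hs hgc hg]
    convert hasSum_single k ?_ using 1
    · rw [integral_ultraspherical_mul_ultraspherical hd, if_pos rfl, cdim_mul_lead_mul_w hd,
        one_mul]
    · intro j hj
      rw [integral_ultraspherical_mul_ultraspherical hd, if_neg hj, mul_zero, zero_mul]
  | zero => simp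
  | add x y _ _ hx hy =>
    simp only [Polynomial.eval_add, mul_add]
    convert hx.add hy using 1
    · ext j
      rw [integral_add, mul_add, add_mul] <;>
        exact integrable_of_continuous_sphere (by fun_prop)
    · rw [integral_add] <;> exact integrable_of_continuous_sphere (by fun_prop)
  | smul c x _ hx =>
    simp only [Polynomial.eval_smul, smul_eq_mul, mul_left_comm _ c, integral_const_mul,
      mul_assoc c]
    exact hx.mul_left c

theorem exists_integral_sphere_mul_one_sub_sq_pow {d : ℕ} (hd : 2 ≤ d) (u : Sph d) (m : ℕ) :
    ∃ κ : ℝ, κ ≠ 0 ∧ ∀ (s : ℝ) (g : ℝ → ℝ), 0 ≤ s → Continuous g → PosHomogeneous s g →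
      (∫ v : Sph d, g ⟪(u : Ed d), (v : Ed d)⟫ * (1 - ⟪(u : Ed d), (v : Ed d)⟫ ^ 2) ^ m ∂ωd d) *
          Gamma ((s + d) / 2 + m) = κ * ((g 1 + g (-1)) * Gamma ((s + 1) / 2)) := by
  have hd2 : (2 : ℝ) ≤ d := by exact_mod_cast hd
  induction m with
  | zero =>
    refine ⟨√π ^ (d - 1), by positivity, fun s g hs hgc hg => ?_⟩
    simp only [pow_zero, mul_one, Nat.cast_zero, add_zero]
    rw [integral_sphere_posHomogeneous (by omega) hs hg]
    linear_combination (g 1 + g (-1)) * w_zero_right (d := d) (by omega) hs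
  | succ m ih =>
    obtain ⟨κ, hκ, ih⟩ := ih
    have hne : ((d : ℝ) - 1) / 2 + m ≠ 0 := by
      have : (0 : ℝ) ≤ m := m.cast_nonneg
      intro h; linarith
    refine ⟨κ * (((d : ℝ) - 1) / 2 + m), mul_ne_zero hκ hne, fun s g hs hgc hg => ?_⟩
    have h1 := ih s g hs hgc hg
    have h2 := ih (s + (2 : ℕ)) (fun x => g x * x ^ 2) (by positivity) (by fun_prop)
      (hg.mul (posHomogeneous_pow 2))
    have hΓ1 : Gamma ((s + d) / 2 + m + 1) = ((s + d) / 2 + m) * Gamma ((s + d) / 2 + m) :=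
      Gamma_add_one (by positivity)
    have hΓ2 : Gamma ((s + 1) / 2 + 1) = (s + 1) / 2 * Gamma ((s + 1) / 2) :=
      Gamma_add_one (by positivity)
    rw [show (s + (2 : ℕ) + (d : ℝ)) / 2 + m = (s + d) / 2 + m + 1 by push_cast; ring,
      show (s + (2 : ℕ) + (1 : ℝ)) / 2 = (s + 1) / 2 + 1 by push_cast; ring, hΓ2] at h2
    have hsub : ∫ v : Sph d, g ⟪(u : Ed d), (v : Ed d)⟫ *
          (1 - ⟪(u : Ed d), (v : Ed d)⟫ ^ 2) ^ (m + 1) ∂ωd d =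
        (∫ v : Sph d, g ⟪(u : Ed d), (v : Ed d)⟫ *
          (1 - ⟪(u : Ed d), (v : Ed d)⟫ ^ 2) ^ m ∂ωd d) -
        ∫ v : Sph d, g ⟪(u : Ed d), (v : Ed d)⟫ * ⟪(u : Ed d), (v : Ed d)⟫ ^ 2 *
          (1 - ⟪(u : Ed d), (v : Ed d)⟫ ^ 2) ^ m ∂ωd d := by
      rw [← integral_sub (integrable_of_continuous_sphere (by fun_prop))
        (integrable_of_continuous_sphere (by fun_prop))]
      congr 1 with v
      ring
    rw [hsub, show (s + (d : ℝ)) / 2 + ((m + 1 : ℕ) : ℝ) = (s + d) / 2 + m + 1 by push_cast; ring,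
      sub_mul, h2, hΓ1]
    norm_num
    linear_combination ((s + d) / 2 + m) * h1

theorem exists_zonal_monomial {d : ℕ} (hd : 2 ≤ d) (u : Sph d)
    (b : OrthonormalBasis (Fin d) ℝ (Ed d)) (i₀ : Fin d) (hb : b i₀ = u) (β : Fin d → ℕ) :
    ∃ q : Polynomial ℝ, ∀ (s : ℝ) (g : ℝ → ℝ), 0 ≤ s → Continuous g → PosHomogeneous s g →
      ∫ v : Sph d, g ⟪(u : Ed d), (v : Ed d)⟫ * ∏ i, ⟪b i, (v : Ed d)⟫ ^ β i ∂ωd d =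
        ∫ v : Sph d, g ⟪(u : Ed d), (v : Ed d)⟫ * q.eval ⟪(u : Ed d), (v : Ed d)⟫ ∂ωd d := by
  set E := ∏ i ∈ Finset.univ.erase i₀, ((1 + (-1) ^ β i) / 2 * Gamma ((β i + 1) / 2)) with hE
  have hΓ : ∀ s : ℝ, 0 ≤ s → Gamma ((s + ∑ i, (β i : ℝ) + d) / 2) ≠ 0 := fun s hs =>
    (Gamma_pos_of_pos (by positivity)).ne'
  by_cases hE0 : E = 0
  · refine ⟨0, fun s g hs hgc hg => ?_⟩
    have h := integral_sphere_mul_monomial b i₀ hs hg β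
    rw [← hE, hE0, mul_zero, hb] at h
    simpa using (mul_eq_zero.1 h).resolve_right (div_ne_zero (hΓ s hs) two_ne_zero)
  · have heven : Even (∑ i ∈ Finset.univ.erase i₀, β i) := by
      refine Finset.even_sum _ fun i hi => ?_
      by_contra hodd
      refine hE0 (Finset.prod_eq_zero hi ?_)
      rw [(Nat.not_even_iff_odd.1 hodd).neg_one_pow]
      simp
    obtain ⟨m, hm⟩ := heven
    have hsum : ∑ i, (β i : ℝ) = β i₀ + 2 * m := by
      rw [← Finset.add_sum_erase _ _ (Finset.mem_univ i₀), ← Nat.cast_sum, hm]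
      push_cast; ring
    obtain ⟨κ, hκ, h⟩ := exists_integral_sphere_mul_one_sub_sq_pow hd u m
    refine ⟨Polynomial.C (E / κ) * (Polynomial.X ^ β i₀ * (1 - Polynomial.X ^ 2) ^ m),
      fun s g hs hgc hg => ?_⟩
    have h1 := integral_sphere_mul_monomial b i₀ hs hg β
    have h2 := h (s + β i₀) (fun x => g x * x ^ β i₀) (by positivity) (by fun_prop)
      (hg.mul (posHomogeneous_pow _))
    have hΓs := hΓ s hs
    rw [← hE, hb] at h1
    rw [show (s + ∑ i, (β i : ℝ) + d) / 2 = (s + β i₀ + d) / 2 + m by rw [hsum]; ring]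
      at h1 hΓs
    simp only [one_pow, mul_one] at h2
    simp only [Polynomial.eval_mul, Polynomial.eval_C, Polynomial.eval_pow, Polynomial.eval_sub,
      Polynomial.eval_one, Polynomial.eval_X, mul_left_comm _ (E / κ), integral_const_mul,
      ← mul_assoc (g _)]
    refine mul_right_cancel₀ hΓs ?_
    rw [mul_assoc (E / κ), h2]
    generalize Gamma ((s + β i₀ + d) / 2 + m) = G at h1 ⊢
    generalize Gamma ((s + β i₀ + 1) / 2) = G' at h1 ⊢
    field_simp
    linear_combination 2 * h1

/-- Integration against zonal homogeneous functions does not distinguish a polynomial from a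
suitable zonal polynomial. -/
theorem exists_zonal_polynomial {d : ℕ} (hd : 2 ≤ d) (u : Sph d) (p : MvPolynomial (Fin d) ℝ) :
    ∃ q : Polynomial ℝ, ∀ (s : ℝ) (g : ℝ → ℝ), 0 ≤ s → Continuous g → PosHomogeneous s g →
      ∫ v : Sph d, g ⟪(u : Ed d), (v : Ed d)⟫ *
          MvPolynomial.eval (fun i => (v : Ed d) i) p ∂ωd d =
        ∫ v : Sph d, g ⟪(u : Ed d), (v : Ed d)⟫ * q.eval ⟪(u : Ed d), (v : Ed d)⟫ ∂ωd d := by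
  obtain ⟨b, hb⟩ := exists_orthonormalBasis_apply_eq (⟨0, by omega⟩ : Fin d) u
  have hcont : ∀ p : MvPolynomial (Fin d) ℝ,
      Continuous fun v : Sph d => MvPolynomial.eval (fun i => ⟪b i, (v : Ed d)⟫) p := fun p =>
    (MvPolynomial.continuous_eval p).comp (by fun_prop)
  have key : ∀ p : MvPolynomial (Fin d) ℝ, ∃ q : Polynomial ℝ, ∀ (s : ℝ) (g : ℝ → ℝ), 0 ≤ s →
      Continuous g → PosHomogeneous s g →
      ∫ v : Sph d, g ⟪(u : Ed d), (v : Ed d)⟫ *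
          MvPolynomial.eval (fun i => ⟪b i, (v : Ed d)⟫) p ∂ωd d =
        ∫ v : Sph d, g ⟪(u : Ed d), (v : Ed d)⟫ * q.eval ⟪(u : Ed d), (v : Ed d)⟫ ∂ωd d := by
    intro p
    induction p using MvPolynomial.induction_on' with
    | monomial β a =>
      obtain ⟨q, hq⟩ := exists_zonal_monomial hd u b _ hb β
      refine ⟨Polynomial.C a * q, fun s g hs hgc hg => ?_⟩
      simp only [MvPolynomial.eval_monomial, Polynomial.eval_mul, Polynomial.eval_C,
        mul_left_comm _ a, integral_const_mul]
      rw [← hq s g hs hgc hg]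
      simp [Finsupp.prod_fintype]
    | add p₁ p₂ h₁ h₂ =>
      obtain ⟨q₁, hq₁⟩ := h₁
      obtain ⟨q₂, hq₂⟩ := h₂
      refine ⟨q₁ + q₂, fun s g hs hgc hg => ?_⟩
      have := hcont p₁
      have := hcont p₂
      simp only [map_add, Polynomial.eval_add, mul_add]
      rw [integral_add, integral_add, hq₁ s g hs hgc hg, hq₂ s g hs hgc hg] <;>
        exact integrable_of_continuous_sphere (by fun_prop)
  obtain ⟨q, hq⟩ := key (MvPolynomial.bind₁
    (fun l => ∑ i, MvPolynomial.C (b i l) * MvPolynomial.X i) p)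
  refine ⟨q, fun s g hs hgc hg => ?_⟩
  rw [← hq s g hs hgc hg]
  congr 1 with v
  congr 1
  unfold MvPolynomial.eval
  rw [MvPolynomial.eval₂Hom_bind₁]
  congr 2 with l
  conv_lhs => rw [← b.sum_repr' (v : Ed d)]
  simp [mul_comm]

theorem hasSum_projR {d : ℕ} (hd : 2 ≤ d) {P : Sph d → ℝ} (hP : IsPolyRestriction d P) (u : Sph d)
    {s : ℝ} (hs : 0 ≤ s) {g : ℝ → ℝ} (hgc : Continuous g) (hg : PosHomogeneous s g) :
    HasSum (fun j : ℕ => projR d j P u * ((g 1 + (-1) ^ j * g (-1)) / 2 * w d s j))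
      (∫ v : Sph d, g ⟪(u : Ed d), (v : Ed d)⟫ * P v ∂ωd d) := by
  have hb : 0 ≤ ((d : ℝ) - 2) / 2 := by
    have : (2 : ℝ) ≤ d := by exact_mod_cast hd
    linarith
  obtain ⟨p, hp⟩ := hP
  obtain rfl : P = fun v : Sph d => MvPolynomial.eval (fun i => (v : Ed d) i) p := funext hp
  obtain ⟨q, hq⟩ := exists_zonal_polynomial hd u p
  have hcont : Continuous fun v : Sph d => MvPolynomial.eval (fun i => (v : Ed d) i) p :=
    (MvPolynomial.continuous_eval p).comp
      (f := fun (v : Sph d) (i : Fin d) => (v : Ed d) i) (by fun_prop)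
  rw [hq s g hs hgc hg]
  convert hasSum_integral_sphere_mul_polynomial hd u hs hgc hg q using 2 with j
  rw [projR]
  congr 2
  simp only [gegenbauerN_eq_eval hb]
  generalize ultraspherical _ j = r
  simp only [Polynomial.eval_eq_sum_range (p := r), Finset.sum_mul, mul_assoc]
  rw [integral_finsetSum _ fun i _ => integrable_of_continuous_sphere (by fun_prop),
    integral_finsetSum _ fun i _ => integrable_of_continuous_sphere (by fun_prop)]
  refine Finset.sum_congr rfl fun i _ => ?_
  rw [integral_const_mul, integral_const_mul,
    hq i _ i.cast_nonneg (continuous_pow i) (posHomogeneous_pow i)]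

theorem exists_eq_cos_smul_add_sin_smul {d : ℕ} (hd : 2 ≤ d) (u v : Sph d) :
    ∃ (x : Ed d) (θ : ℝ), ‖x‖ = 1 ∧ ⟪(u : Ed d), x⟫ = 0 ∧
      (v : Ed d) = cos θ • (u : Ed d) + sin θ • x := by
  have hu : ‖(u : Ed d)‖ = 1 := norm_eq_of_mem_sphere u
  have hv : ‖(v : Ed d)‖ = 1 := norm_eq_of_mem_sphere v
  set c : ℝ := ⟪(u : Ed d), (v : Ed d)⟫ with hc
  set y : Ed d := (v : Ed d) - c • (u : Ed d) with hy
  have horth : ⟪(u : Ed d), y⟫ = 0 := by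
    rw [hy, inner_sub_right, inner_smul_right, real_inner_self_eq_norm_sq, hu, ← hc]
    ring
  have hnorm : ‖y‖ ^ 2 = 1 - c ^ 2 := by
    rw [hy, norm_sub_sq_real, inner_smul_right, real_inner_comm, ← hc, norm_smul, hu, hv,
      mul_one, norm_eq_abs, sq_abs]
    ring
  have habs : |c| ≤ 1 := by
    simpa [hu, hv] using abs_real_inner_le_norm (u : Ed d) (v : Ed d)
  have hsin : sin (arccos c) = ‖y‖ := by
    rw [sin_arccos, ← hnorm, sqrt_sq (norm_nonneg y)]
  have hcos : cos (arccos c) = c := cos_arccos (neg_le_of_abs_le habs) (le_of_abs_le habs)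
  by_cases h0 : y = 0
  · obtain ⟨b, hb⟩ := exists_orthonormalBasis_apply_eq (⟨0, by omega⟩ : Fin d) u
    refine ⟨b ⟨1, by omega⟩, arccos c, b.orthonormal.1 _, ?_, ?_⟩
    · rw [← hb]
      exact b.orthonormal.2 (by simp)
    · rw [hcos, hsin, h0, norm_zero, zero_smul, add_zero]
      exact sub_eq_zero.1 h0
  · have hn : ‖y‖ ≠ 0 := norm_ne_zero_iff.2 h0
    refine ⟨‖y‖⁻¹ • y, arccos c, ?_, ?_, ?_⟩
    · rw [norm_smul, norm_inv, norm_norm, inv_mul_cancel₀ hn]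
    · rw [inner_smul_right, horth, mul_zero]
    · rw [hcos, hsin, smul_smul, mul_inv_cancel₀ hn, one_smul, hy]
      abel

theorem eval_eq_zero_of_forall_inner_pos {d : ℕ} (hd : 2 ≤ d) (u : Sph d)
    (p : MvPolynomial (Fin d) ℝ)
    (h : ∀ v : Sph d, 0 < ⟪(u : Ed d), (v : Ed d)⟫ →
      MvPolynomial.eval (fun i => (v : Ed d) i) p = 0) (v : Sph d) :
    MvPolynomial.eval (fun i => (v : Ed d) i) p = 0 := by
  have hu : ‖(u : Ed d)‖ = 1 := norm_eq_of_mem_sphere u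
  obtain ⟨x, θ, hx, hux, hv⟩ := exists_eq_cos_smul_add_sin_smul hd u v
  set γ : ℝ → Ed d := fun τ => cos τ • (u : Ed d) + sin τ • x with hγ
  have hmem : ∀ τ, γ τ ∈ Metric.sphere (0 : Ed d) 1 := fun τ => by
    rw [mem_sphere_zero_iff_norm, ← sq_eq_sq₀ (norm_nonneg _) zero_le_one, hγ, norm_add_sq_real,
      inner_smul_left, inner_smul_right, hux, norm_smul, norm_smul, hu, hx]
    simp
  have hinner : ∀ τ, ⟪(u : Ed d), γ τ⟫ = cos τ := fun τ => by
    rw [hγ, inner_add_right, inner_smul_right, inner_smul_right, hux,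
      real_inner_self_eq_norm_sq, hu]
    simp
  have han : AnalyticOnNhd ℝ (fun τ => MvPolynomial.eval (fun i => γ τ i) p) Set.univ := by
    intro τ _
    have hcoord : ∀ i, AnalyticAt ℝ (fun τ => γ τ i) τ := fun i => by
      simp only [hγ, PiLp.add_apply, PiLp.smul_apply, smul_eq_mul]
      fun_prop
    simpa only [MvPolynomial.aeval_eq_eval] using AnalyticAt.aeval_mvPolynomial hcoord p
  have hzero : (fun τ => MvPolynomial.eval (fun i => γ τ i) p) =ᶠ[𝓝 0] fun _ => 0 := by
    have : ∀ᶠ τ in 𝓝 (0 : ℝ), 0 < cos τ :=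
      continuous_cos.continuousAt.eventually (lt_mem_nhds (by simp))
    filter_upwards [this] with τ hτ
    exact h ⟨γ τ, hmem τ⟩ (by rw [hinner]; exact hτ)
  have := congrFun (han.eq_of_eventuallyEq analyticOnNhd_const hzero) θ
  rw [hv]
  exact this

theorem integral_sphere_pos {d : ℕ} (hd : 2 ≤ d) {P : Sph d → ℝ} (hpoly : IsPolyRestriction d P)
    (hP0 : ∀ u, 0 ≤ P u) (hPne : P ≠ 0) {g : ℝ → ℝ} (hgc : Continuous g) (hg0 : ∀ t, 0 ≤ g t)
    (hg : ∀ t, 0 < t → 0 < g t) (u : Sph d) :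
    0 < ∫ v : Sph d, g ⟪(u : Ed d), (v : Ed d)⟫ * P v ∂ωd d := by
  obtain ⟨p, hp⟩ := hpoly
  have hPc : Continuous P := by
    rw [funext hp]
    exact (MvPolynomial.continuous_eval p).comp
      (f := fun (v : Sph d) (i : Fin d) => (v : Ed d) i) (by fun_prop)
  obtain ⟨v, hv, hPv⟩ : ∃ v : Sph d, 0 < ⟪(u : Ed d), (v : Ed d)⟫ ∧ P v ≠ 0 := by
    by_contra! hcon
    refine hPne (funext fun v => ?_)
    rw [hp]
    exact eval_eq_zero_of_forall_inner_pos hd u p (fun v hv => hp v ▸ hcon v hv) v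
  exact Continuous.integral_pos_of_hasCompactSupport_nonneg_nonzero (by fun_prop)
    (HasCompactSupport.of_compactSpace _) (fun v => mul_nonneg (hg0 _) (hP0 v))
    (mul_ne_zero (hg _ hv).ne' hPv)

theorem posHomogeneous_max_rpow {α : ℝ} (ε : ℝ) :
    PosHomogeneous α (fun t => max (ε * t) 0 ^ α) := by
  intro r hr t
  rw [← mul_rpow hr.le (le_max_right _ _), mul_max_of_nonneg _ _ hr.le, mul_zero, mul_left_comm]

/-- Corollary: for a polynomial spectral spherical density `P ≠ 0`, the strict
inequality `Σ_{j even} w_j(α) P_j(u) > |Σ_{j odd} w_j(α) P_j(u)|` holds for all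
`α ∈ (0,2)` and `u ∈ S^{d-1}`. -/
theorem stmt5 (d : ℕ) (hd : 2 ≤ d) (P : Sph d → ℝ)
    (hpoly : IsPolyRestriction d P) (hP0 : ∀ u, 0 ≤ P u) (hPne : P ≠ 0) :
    ∀ α : ℝ, 0 < α → α < 2 → ∀ u : Sph d,
      |∑' j : ℕ, if Odd j then w d α j * projR d j P u else 0| <
        ∑' j : ℕ, if Even j then w d α j * projR d j P u else 0 := by
  intro α hα _ u
  have hcont : ∀ ε : ℝ, Continuous fun t : ℝ => max (ε * t) 0 ^ α := fun ε =>
    Continuous.rpow_const (by fun_prop) fun _ => Or.inr hα.le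
  have hsum : ∀ ε : ℝ, _ := fun ε =>
    hasSum_projR hd hpoly u hα.le (hcont ε) (posHomogeneous_max_rpow ε)
  set I : ℝ → ℝ := fun ε =>
    ∫ v : Sph d, max (ε * ⟪(u : Ed d), (v : Ed d)⟫) 0 ^ α * P v ∂ωd d with hI
  have hpos : 0 < I 1 := integral_sphere_pos hd hpoly hP0 hPne (hcont 1)
    (fun t => rpow_nonneg (le_max_right _ _) _)
    (fun t ht => rpow_pos_of_pos (lt_max_of_lt_left (by simpa)) _) u
  have hneg : 0 < I (-1) := by
    have := integral_sphere_pos hd hpoly hP0 hPne (hcont 1)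
      (fun t => rpow_nonneg (le_max_right _ _) _)
      (fun t ht => rpow_pos_of_pos (lt_max_of_lt_left (by simpa)) _) (negS u)
    simpa [hI, negS] using this
  have heven : HasSum (fun j : ℕ => if Even j then w d α j * projR d j P u else 0)
      (I 1 + I (-1)) := by
    convert (hsum 1).add (hsum (-1)) using 2 with j
    rcases Nat.even_or_odd j with hj | hj
    · simp [hj, hj.neg_one_pow, zero_rpow hα.ne']; ring
    · simp [Nat.not_even_iff_odd.2 hj, hj.neg_one_pow, zero_rpow hα.ne']; ring
  have hodd : HasSum (fun j : ℕ => if Odd j then w d α j * projR d j P u else 0)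
      (I 1 - I (-1)) := by
    refine ((hsum 1).sub (hsum (-1))).congr_fun fun j => ?_
    rcases Nat.even_or_odd j with hj | hj
    · simp [Nat.not_odd_iff_even.2 hj, hj.neg_one_pow, zero_rpow hα.ne']
    · simp [hj, hj.neg_one_pow, zero_rpow hα.ne']; ring
  rw [heven.tsum_eq, hodd.tsum_eq, abs_lt]
  constructor <;> linarith

end StablePaper
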